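/- For the DRB game on the k-dimensional grid, there exists n0 ∈ ℕ (depending only on k and the granularity γ) such that for all n ≥ n0: from every strategy profile r with r ≢ 0 (i.e., r_u > 0 for some node u), there exists a finite sequence of asynchronous best-response steps that ends at the navigable profile r ≡ k. -/

import Mathlib

open Finset

noncomputable section

namespace DRB

/-- Nodes of the `k`-dimensional grid (torus) with side length `n`. -/
abbrev Node (n k : ℕ) := Fin k → Fin n

/-- Grid (Manhattan) distance on the torus:
`d_M(u,v) = Σ_i min(|u_i - v_i|, n - |u_i - v_i|)`. -/
def dM (n k : ℕ) (u v : Node n k) : ℕ :=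
  ∑ i, min ((u i : ℤ) - (v i : ℤ)).natAbs (n - ((u i : ℤ) - (v i : ℤ)).natAbs)

/-- All nodes different from `u`. -/
def others (n k : ℕ) (u : Node n k) : Finset (Node n k) :=
  Finset.univ.filter (fun v => v ≠ u)

/-- Normalization constant `c(s) = Σ_{v ≠ u} d_M(u,v)^{-s}` for node `u`. -/
def cnorm (n k : ℕ) (u : Node n k) (s : ℝ) : ℝ :=
  ∑ v ∈ others n k u, (dM n k u v : ℝ) ^ (-s)

/-- Long-range link probability `p_u(v, s) = d_M(u,v)^{-s} / c(s)`. -/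
def linkProb (n k : ℕ) (u v : Node n k) (s : ℝ) : ℝ :=
  (dM n k u v : ℝ) ^ (-s) / cnorm n k u s

/-- Link distance `D(s) = Σ_{v ≠ u} p_u(v,s) · d_M(u,v)` of node `u`. -/
def linkDist (n k : ℕ) (u : Node n k) (s : ℝ) : ℝ :=
  ∑ v ∈ others n k u, linkProb n k u v s * (dM n k u v : ℝ)

/-- Reciprocity `P_u(r) = Σ_{v ≠ u} p_u(v, r_u) · p_v(u, r_v)`. -/
def recip (n k : ℕ) (r : Node n k → ℝ) (u : Node n k) : ℝ :=
  ∑ v ∈ others n k u, linkProb n k u v (r u) * linkProb n k v u (r v)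

/-- DRB payoff `π_u(r) = D(r_u) · P_u(r)`. -/
def payoff (n k : ℕ) (r : Node n k → ℝ) (u : Node n k) : ℝ :=
  linkDist n k u (r u) * recip n k r u

/-- Membership in the strategy set `Σ = {0, γ, 2γ, 3γ, ...}`. -/
def InSigma (γ s : ℝ) : Prop := ∃ m : ℕ, s = m * γ

/-- A valid strategy profile (every coordinate lies in `Σ`). -/
def ValidProfile (n k : ℕ) (γ : ℝ) (r : Node n k → ℝ) : Prop :=
  ∀ u, InSigma γ (r u)

/-- Nash equilibrium of the DRB game with strategy set `Σ` of granularity `γ`. -/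
def IsNash (n k : ℕ) (γ : ℝ) (r : Node n k → ℝ) : Prop :=
  ∀ u : Node n k, ∀ s : ℝ, InSigma γ s →
    payoff n k r u ≥ payoff n k (Function.update r u s) u

/-- Strict Nash equilibrium. -/
def IsStrictNash (n k : ℕ) (γ : ℝ) (r : Node n k → ℝ) : Prop :=
  ∀ u : Node n k, ∀ s : ℝ, InSigma γ s → s ≠ r u →
    payoff n k r u > payoff n k (Function.update r u s) u

/-- `t`-strong Nash equilibrium: no coalition of size ≤ `t` has a weakly
improving joint deviation that strictly improves some member. -/
def IsTStrongNash (n k : ℕ) (γ : ℝ) (t : ℕ) (r : Node n k → ℝ) : Prop :=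
  ¬ ∃ (C : Finset (Node n k)) (s : Node n k → ℝ),
      C.Nonempty ∧ C.card ≤ t ∧ (∀ u ∈ C, InSigma γ (s u)) ∧
      (∀ u ∈ C,
        payoff n k (fun v => if v ∈ C then s v else r v) u ≥ payoff n k r u) ∧
      (∃ u ∈ C,
        payoff n k (fun v => if v ∈ C then s v else r v) u > payoff n k r u)

/-- Strong Nash equilibrium: coalitions of any size. -/
def IsStrongNash (n k : ℕ) (γ : ℝ) (r : Node n k → ℝ) : Prop :=
  ¬ ∃ (C : Finset (Node n k)) (s : Node n k → ℝ),
      C.Nonempty ∧ (∀ u ∈ C, InSigma γ (s u)) ∧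
      (∀ u ∈ C,
        payoff n k (fun v => if v ∈ C then s v else r v) u ≥ payoff n k r u) ∧
      (∃ u ∈ C,
        payoff n k (fun v => if v ∈ C then s v else r v) u > payoff n k r u)

/-- `b_u(j)`: the number of nodes at grid distance exactly `j` from `u`. -/
def countAt (n k : ℕ) (u : Node n k) (j : ℕ) : ℕ :=
  (Finset.univ.filter (fun v => v ≠ u ∧ dM n k u v = j)).card

/-- One asynchronous best-response step: a single node switches to a best
response to the current profile, all other strategies unchanged. -/
def BRStep (n k : ℕ) (γ : ℝ) (r r' : Node n k → ℝ) : Prop :=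
  ∃ (u : Node n k) (s : ℝ), InSigma γ s ∧
    (∀ t : ℝ, InSigma γ t →
      payoff n k (Function.update r u s) u ≥ payoff n k (Function.update r u t) u) ∧
    r' = Function.update r u s

/-- One synchronous best-response step: every node simultaneously switches
to a best response to the current profile `r`. -/
def SyncStep (n k : ℕ) (γ : ℝ) (r r' : Node n k → ℝ) : Prop :=
  ∀ u : Node n k, InSigma γ (r' u) ∧
    ∀ t : ℝ, InSigma γ t →
      payoff n k (Function.update r u (r' u)) u ≥
        payoff n k (Function.update r u t) u

end DRB


namespace DRB

theorem core_aux {ι : Type*} (S : Finset ι) (d q : ι → ℝ) (k g : ℕ) (hk : 1 ≤ k) (hg : 2 ≤ g)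
    (M Λ B : ℝ) (w : ι) (hw : w ∈ S) (hdw : d w = 1)
    (hd1 : ∀ v ∈ S, 1 ≤ d v) (hdM : ∀ v ∈ S, d v ≤ M)
    (hΛ1 : 1 ≤ Λ) (hB1 : 1 ≤ B)
    (hΛ : ∑ v ∈ S, d v ^ (-(k:ℝ)) ≤ Λ)
    (hcard : M ^ (k:ℝ) ≤ B * (S.card : ℝ))
    (hq0 : ∀ v ∈ S, 0 ≤ q v)
    (hq : ∀ v ∈ S, q v ≤ B * d v ^ (-(k:ℝ)))
    (hqw : M ^ (-((k:ℝ) - (g:ℝ)⁻¹)) ≤ Λ * q w)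
    (hbig : 2 * B ^ 3 * Λ ^ 4 * (2 * B ^ 2 * Λ ^ 2) ^ (g * k) ≤ M ^ ((g:ℝ)⁻¹))
    (s : ℝ) (hs0 : 0 ≤ s) (hs : s = k ∨ s ≤ k - (g:ℝ)⁻¹ ∨ k + (g:ℝ)⁻¹ ≤ s) :
    (∑ v ∈ S, d v ^ (-s) / (∑ v ∈ S, d v ^ (-s)) * d v) *
      (∑ v ∈ S, d v ^ (-s) / (∑ v ∈ S, d v ^ (-s)) * q v) ≤
    (∑ v ∈ S, d v ^ (-(k:ℝ)) / (∑ v ∈ S, d v ^ (-(k:ℝ))) * d v) *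
      (∑ v ∈ S, d v ^ (-(k:ℝ)) / (∑ v ∈ S, d v ^ (-(k:ℝ))) * q v) := by
  have hkR : (1:ℝ) ≤ k := by exact_mod_cast hk
  have hgR : (2:ℝ) ≤ g := by exact_mod_cast hg
  set γ : ℝ := (g:ℝ)⁻¹ with hγ
  have hγ0 : 0 < γ := by positivity
  have hM1 : 1 ≤ M := (hd1 w hw).trans (hdM w hw)
  have hM0 : 0 < M := by linarith
  have hd0 : ∀ v ∈ S, 0 < d v := fun v hv => by linarith [hd1 v hv]
  have key : ∀ t : ℝ, (∑ v ∈ S, d v ^ (-t) / (∑ v ∈ S, d v ^ (-t)) * d v) *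
      (∑ v ∈ S, d v ^ (-t) / (∑ v ∈ S, d v ^ (-t)) * q v) =
      (∑ v ∈ S, d v ^ (-t) * d v) * (∑ v ∈ S, d v ^ (-t) * q v) / (∑ v ∈ S, d v ^ (-t)) ^ 2 := by
    intro t
    have e : ∀ f : ι → ℝ, ∑ v ∈ S, d v ^ (-t) / (∑ v ∈ S, d v ^ (-t)) * f v
        = (∑ v ∈ S, d v ^ (-t) * f v) / (∑ v ∈ S, d v ^ (-t)) := by
      intro f
      rw [Finset.sum_div]
      exact Finset.sum_congr rfl fun v _ => by ring
    rw [e, e]; ring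
  have hc1 : ∀ t : ℝ, 1 ≤ ∑ v ∈ S, d v ^ (-t) := by
    intro t
    have := Finset.single_le_sum (f := fun v => d v ^ (-t))
      (fun v hv => (Real.rpow_pos_of_pos (hd0 v hv) _).le) hw
    simpa [hdw] using this
  rcases hs with rfl | hs
  · exact le_rfl
  rw [key, key]
  set Q : ℝ := ∑ v ∈ S, d v ^ (-(k:ℝ)) * q v with hQ
  have hQ0 : 0 ≤ Q := Finset.sum_nonneg fun v hv =>
    mul_nonneg (Real.rpow_pos_of_pos (hd0 v hv) _).le (hq0 v hv)
  -- lower bound on the payoff at k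
  have hlow : M / B * Q / Λ ^ 2 ≤
      (∑ v ∈ S, d v ^ (-(k:ℝ)) * d v) * Q / (∑ v ∈ S, d v ^ (-(k:ℝ))) ^ 2 := by
    have hX : M / B ≤ ∑ v ∈ S, d v ^ (-(k:ℝ)) * d v := by
      have h1 : (S.card : ℝ) * M ^ (1 - (k:ℝ)) ≤ ∑ v ∈ S, d v ^ (-(k:ℝ)) * d v := by
        rw [← nsmul_eq_mul]
        apply Finset.card_nsmul_le_sum
        intro v hv
        have : d v ^ (-(k:ℝ)) * d v = d v ^ (1 - (k:ℝ)) := by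
          rw [sub_eq_neg_add, Real.rpow_add (hd0 v hv), Real.rpow_one]
        rw [this]
        exact Real.rpow_le_rpow_of_nonpos (hd0 v hv) (hdM v hv) (by linarith)
      refine le_trans ?_ h1
      rw [div_le_iff₀ (by linarith)]
      have h2 : M = M ^ (k:ℝ) * M ^ (1 - (k:ℝ)) := by
        rw [← Real.rpow_add hM0]; simp
      have h3 := mul_le_mul_of_nonneg_right hcard (Real.rpow_pos_of_pos hM0 (1 - (k:ℝ))).le
      rw [← h2] at h3
      linarith
    have hc := hc1 k
    have hP : 0 ≤ (∑ v ∈ S, d v ^ (-(k:ℝ)) * d v) * Q :=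
      mul_nonneg (le_trans (by positivity) hX) hQ0
    gcongr
  refine le_trans ?_ hlow
  have hbig0 : (1:ℝ) ≤ (2 * B ^ 2 * Λ ^ 2) := by
    have h1 : 1 ≤ B ^ 2 := one_le_pow₀ hB1
    have h2 : 1 ≤ Λ ^ 2 := one_le_pow₀ hΛ1
    nlinarith
  rcases hs with hs | hs
  · -- small s
    have hcs : M ^ (k - s) ≤ B * ∑ v ∈ S, d v ^ (-s) := by
      have h1 : (S.card : ℝ) * M ^ (-s) ≤ ∑ v ∈ S, d v ^ (-s) := by
        rw [← nsmul_eq_mul]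
        apply Finset.card_nsmul_le_sum
        intro v hv
        exact Real.rpow_le_rpow_of_nonpos (hd0 v hv) (hdM v hv) (by linarith)
      rw [sub_eq_add_neg, Real.rpow_add hM0]
      calc _ ≤ B * (S.card : ℝ) * M ^ (-s) := by gcongr
        _ = B * ((S.card : ℝ) * M ^ (-s)) := by ring
        _ ≤ _ := by gcongr
    set c := ∑ v ∈ S, d v ^ (-s) with hcdef
    have hc := hc1 s
    rw [← hcdef] at hc
    set Qs := ∑ v ∈ S, d v ^ (-s) * q v with hQs
    have hQs0 : 0 ≤ Qs := Finset.sum_nonneg fun v hv =>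
      mul_nonneg (Real.rpow_pos_of_pos (hd0 v hv) _).le (hq0 v hv)
    have hX : ∑ v ∈ S, d v ^ (-s) * d v ≤ c * M := by
      rw [hcdef, Finset.sum_mul]
      refine Finset.sum_le_sum fun v hv => ?_
      exact mul_le_mul_of_nonneg_left (hdM v hv) (Real.rpow_pos_of_pos (hd0 v hv) _).le
    have hmain : B ^ 2 * Λ ^ 2 * (Qs * M ^ (s - k)) ≤ Q := by
      set W := 2 * B ^ 2 * Λ ^ 2 with hW
      set θ : ℝ := (W ^ g)⁻¹ with hθ
      have hW0 : 0 < W := by linarith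
      have hθ0 : 0 < θ := by positivity
      have hθγ : W * θ ^ γ = 1 := by
        rw [hθ, Real.inv_rpow (by positivity), hγ, Real.pow_rpow_inv_natCast hW0.le (by omega)]
        field_simp
      have hterm : ∀ v ∈ S, B ^ 2 * Λ ^ 2 * (d v ^ (-s) * q v * M ^ (s - k)) ≤
          1 / 2 * (d v ^ (-(k:ℝ)) * q v) + B ^ 3 * Λ ^ 2 * (θ * M) ^ (-(k:ℝ)) * d v ^ (-(k:ℝ)) := by
        intro v hv
        have hdv := hd0 v hv
        have e1 : d v ^ (-s) * q v * M ^ (s - k) ≤ d v ^ (-(k:ℝ)) * q v * (d v / M) ^ γ := by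
          have e2 : d v ^ (-s) * M ^ (s - k) = d v ^ (-(k:ℝ)) * (d v / M) ^ (k - s) := by
            rw [Real.div_rpow hdv.le hM0.le, div_eq_mul_inv, ← Real.rpow_neg hM0.le,
              ← mul_assoc, ← Real.rpow_add hdv]
            ring_nf
          have e3 : (d v / M) ^ (k - s) ≤ (d v / M) ^ γ := by
            apply Real.rpow_le_rpow_of_exponent_ge (by positivity)
            · rw [div_le_one hM0]; exact hdM v hv
            · linarith
          calc _ = d v ^ (-s) * M ^ (s - k) * q v := by ring
            _ = d v ^ (-(k:ℝ)) * q v * (d v / M) ^ (k - s) := by rw [e2]; ring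
            _ ≤ _ := mul_le_mul_of_nonneg_left e3 (mul_nonneg (by positivity) (hq0 v hv))
        have hA : 0 ≤ d v ^ (-(k:ℝ)) * q v := mul_nonneg (by positivity) (hq0 v hv)
        have hB : 0 ≤ B ^ 3 * Λ ^ 2 * (θ * M) ^ (-(k:ℝ)) * d v ^ (-(k:ℝ)) := by positivity
        rcases le_total (d v) (θ * M) with h | h
        · have e4 : (d v / M) ^ γ ≤ θ ^ γ := by
            apply Real.rpow_le_rpow (by positivity) _ hγ0.le
            rw [div_le_iff₀ hM0]; exact h
          have e5 : B ^ 2 * Λ ^ 2 * (d v ^ (-s) * q v * M ^ (s - k)) ≤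
              B ^ 2 * Λ ^ 2 * (d v ^ (-(k:ℝ)) * q v * θ ^ γ) := by
            apply mul_le_mul_of_nonneg_left _ (by positivity)
            exact e1.trans (mul_le_mul_of_nonneg_left e4 hA)
          have e6 : B ^ 2 * Λ ^ 2 * (d v ^ (-(k:ℝ)) * q v * θ ^ γ) =
              1 / 2 * (d v ^ (-(k:ℝ)) * q v) * (W * θ ^ γ) := by rw [hW]; ring
          rw [e6, hθγ] at e5
          linarith
        · have e4 : (d v / M) ^ γ ≤ 1 := by
            apply Real.rpow_le_one (by positivity) _ hγ0.le
            rw [div_le_one hM0]; exact hdM v hv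
          have e5 : q v ≤ B * (θ * M) ^ (-(k:ℝ)) := by
            refine (hq v hv).trans (mul_le_mul_of_nonneg_left ?_ (by linarith))
            exact Real.rpow_le_rpow_of_nonpos (by positivity) h (by linarith)
          have e7 : d v ^ (-s) * q v * M ^ (s - k) ≤ d v ^ (-(k:ℝ)) * (B * (θ * M) ^ (-(k:ℝ))) := by
            calc _ ≤ _ := e1
              _ ≤ d v ^ (-(k:ℝ)) * q v * 1 := mul_le_mul_of_nonneg_left e4 hA
              _ = d v ^ (-(k:ℝ)) * q v := by ring
              _ ≤ _ := mul_le_mul_of_nonneg_left e5 (by positivity)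
          have e8 := mul_le_mul_of_nonneg_left e7 (show 0 ≤ B ^ 2 * Λ ^ 2 by positivity)
          nlinarith
      have hsum := Finset.sum_le_sum hterm
      rw [← Finset.mul_sum, ← Finset.sum_mul, Finset.sum_add_distrib, ← Finset.mul_sum,
        ← Finset.mul_sum, ← hQ, ← hQs] at hsum
      have hfin : B ^ 3 * Λ ^ 2 * (θ * M) ^ (-(k:ℝ)) * ∑ v ∈ S, d v ^ (-(k:ℝ)) ≤ 1 / 2 * Q := by
        have hQw : q w ≤ Q := by
          have := Finset.single_le_sum (f := fun v => d v ^ (-(k:ℝ)) * q v)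
            (fun v hv => mul_nonneg (Real.rpow_pos_of_pos (hd0 v hv) _).le (hq0 v hv)) hw
          simp only [hdw, Real.one_rpow, one_mul] at this
          exact this
        have f1 : (θ * M) ^ (-(k:ℝ)) = W ^ (g * k) * M ^ (-(k:ℝ)) := by
          rw [Real.mul_rpow hθ0.le hM0.le, Real.rpow_neg hθ0.le, hθ, Real.rpow_natCast,
            inv_pow, inv_inv, pow_mul]
        have f2 : M ^ (-((k:ℝ) - γ)) = M ^ (-(k:ℝ)) * M ^ γ := by
          rw [← Real.rpow_add hM0]; ring_nf
        have f3 : B ^ 3 * Λ ^ 2 * (θ * M) ^ (-(k:ℝ)) * ∑ v ∈ S, d v ^ (-(k:ℝ)) ≤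
            B ^ 3 * Λ ^ 2 * (θ * M) ^ (-(k:ℝ)) * Λ :=
          mul_le_mul_of_nonneg_left hΛ (by positivity)
        have f4 : Λ * (2 * (B ^ 3 * Λ ^ 2 * (θ * M) ^ (-(k:ℝ)) * Λ)) ≤ Λ * q w := by
          calc _ = (2 * B ^ 3 * Λ ^ 4 * W ^ (g * k)) * M ^ (-(k:ℝ)) := by rw [f1]; ring
            _ ≤ M ^ γ * M ^ (-(k:ℝ)) := mul_le_mul_of_nonneg_right hbig (by positivity)
            _ = M ^ (-((k:ℝ) - γ)) := by rw [f2]; ring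
            _ ≤ _ := hqw
        have f5 := le_of_mul_le_mul_left f4 (by linarith)
        linarith
      linarith
    have e1 : (∑ v ∈ S, d v ^ (-s) * d v) * Qs / c ^ 2 ≤ M * Qs / c := by
      calc _ ≤ (c * M) * Qs / c ^ 2 := by gcongr
        _ = _ := by field_simp
    have e2 : M * Qs / c ≤ M * Qs * (B * M ^ (s - k)) := by
      rw [div_eq_mul_inv]
      apply mul_le_mul_of_nonneg_left _ (by positivity)
      rw [inv_le_iff_one_le_mul₀ (by linarith)]
      have : M ^ (s - k) * M ^ (k - s) = 1 := by
        rw [← Real.rpow_add hM0]; simp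
      have h4 := mul_le_mul_of_nonneg_left hcs (Real.rpow_pos_of_pos hM0 (s - k)).le
      nlinarith
    refine e1.trans (e2.trans ?_)
    rw [le_div_iff₀ (by positivity), div_mul_eq_mul_div, le_div_iff₀ (by linarith)]
    calc _ = M * (B ^ 2 * Λ ^ 2 * (Qs * M ^ (s - k))) := by ring
      _ ≤ _ := by gcongr
  · -- large s
    have hc := hc1 s
    have hX : ∑ v ∈ S, d v ^ (-s) * d v ≤ Λ * M ^ (1 - γ) := by
      refine le_trans ?_ (mul_le_mul_of_nonneg_right hΛ (by positivity))
      rw [Finset.sum_mul]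
      refine Finset.sum_le_sum fun v hv => ?_
      have hdv := hd0 v hv
      calc d v ^ (-s) * d v ≤ d v ^ (-(k:ℝ) - γ) * d v := by
            apply mul_le_mul_of_nonneg_right _ hdv.le
            exact Real.rpow_le_rpow_of_exponent_le (hd1 v hv) (by linarith)
        _ = d v ^ (-(k:ℝ)) * d v ^ (1 - γ) := by
            nth_rw 2 [← Real.rpow_one (d v)]
            rw [← Real.rpow_add hdv, ← Real.rpow_add hdv]; ring_nf
        _ ≤ _ := by
            apply mul_le_mul_of_nonneg_left _ (by positivity)
            apply Real.rpow_le_rpow hdv.le (hdM v hv)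
            have : γ ≤ 1 := inv_le_one_of_one_le₀ (by linarith)
            linarith
    have hQs : ∑ v ∈ S, d v ^ (-s) * q v ≤ Q := by
      refine Finset.sum_le_sum fun v hv => mul_le_mul_of_nonneg_right ?_ (hq0 v hv)
      exact Real.rpow_le_rpow_of_exponent_le (hd1 v hv) (by linarith)
    have hX0 : 0 ≤ ∑ v ∈ S, d v ^ (-s) * d v := Finset.sum_nonneg fun v hv =>
      mul_nonneg (Real.rpow_pos_of_pos (hd0 v hv) _).le (hd0 v hv).le
    have hQs0 : 0 ≤ ∑ v ∈ S, d v ^ (-s) * q v := Finset.sum_nonneg fun v hv =>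
      mul_nonneg (Real.rpow_pos_of_pos (hd0 v hv) _).le (hq0 v hv)
    have e1 : (∑ v ∈ S, d v ^ (-s) * d v) * (∑ v ∈ S, d v ^ (-s) * q v) / (∑ v ∈ S, d v ^ (-s)) ^ 2
        ≤ Λ * M ^ (1 - γ) * Q := by
      refine (div_le_self (by positivity) (one_le_pow₀ hc)).trans ?_
      gcongr
    refine e1.trans ?_
    have hsm : B * Λ ^ 3 ≤ M ^ γ := by
      refine le_trans ?_ hbig
      have h1 : 1 ≤ (2 * B ^ 2 * Λ ^ 2) ^ (g * k) := one_le_pow₀ hbig0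
      have h2 : B ≤ B ^ 3 := le_self_pow₀ hB1 (by norm_num)
      have h3 : Λ ^ 3 ≤ Λ ^ 4 := pow_le_pow_right₀ hΛ1 (by norm_num)
      have h4 : B * Λ ^ 3 ≤ B ^ 3 * Λ ^ 4 := by gcongr
      have h5 : 0 ≤ B ^ 3 * Λ ^ 4 := by positivity
      calc B * Λ ^ 3 ≤ 2 * B ^ 3 * Λ ^ 4 * 1 := by linarith
        _ ≤ _ := mul_le_mul_of_nonneg_left h1 (by positivity)
    rw [le_div_iff₀ (by positivity), div_mul_eq_mul_div, le_div_iff₀ (by linarith)]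
    have : M ^ (1 - γ) * M ^ γ = M := by rw [← Real.rpow_add hM0]; simp
    calc _ = M ^ (1 - γ) * (B * Λ ^ 3) * Q := by ring
      _ ≤ M ^ (1 - γ) * M ^ γ * Q := by gcongr
      _ = _ := by rw [this]
end DRB

namespace DRB

theorem dM_comm (n k : ℕ) (u v : Node n k) : dM n k u v = dM n k v u := by
  unfold dM
  refine Finset.sum_congr rfl fun i _ => ?_
  rw [← Int.natAbs_neg, neg_sub]

theorem dM_le (n k : ℕ) (u v : Node n k) : dM n k u v ≤ k * n := by
  unfold dM
  calc _ ≤ ∑ _i : Fin k, n := Finset.sum_le_sum fun i _ =>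
        (min_le_right _ _).trans (Nat.sub_le _ _)
    _ = k * n := by simp

theorem one_le_dM (n k : ℕ) (u v : Node n k) (h : v ≠ u) : 1 ≤ dM n k u v := by
  obtain ⟨i, hi⟩ := Function.ne_iff.mp h
  unfold dM
  have h1 : 1 ≤ min ((u i : ℤ) - (v i : ℤ)).natAbs (n - ((u i : ℤ) - (v i : ℤ)).natAbs) := by
    have h2 : (v i : ℕ) ≠ u i := fun h => hi (Fin.ext h)
    have := (u i).isLt
    have := (v i).isLt
    omega
  exact h1.trans (Finset.single_le_sum
    (f := fun i => min ((u i : ℤ) - (v i : ℤ)).natAbs (n - ((u i : ℤ) - (v i : ℤ)).natAbs))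
    (fun _ _ => Nat.zero_le _) (Finset.mem_univ i))

/-- cyclic successor in coordinate `i` -/
def shift (n k : ℕ) [NeZero n] (i : Fin k) (u : Node n k) : Node n k :=
  Function.update u i (u i + 1)

theorem shift_ne (n k : ℕ) [NeZero n] (hn : 2 ≤ n) (i : Fin k) (u : Node n k) :
    shift n k i u ≠ u := by
  intro h
  have := congrFun h i
  simp only [shift, Function.update_self] at this
  have h2 := congrArg Fin.val this
  rw [Fin.val_add, Fin.val_one', Nat.mod_eq_of_lt (show 1 < n by omega)] at h2
  have := (u i).isLt
  rcases Nat.lt_or_ge ((u i : ℕ) + 1) n with h3 | h3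
  · rw [Nat.mod_eq_of_lt h3] at h2; omega
  · have h4 : (u i : ℕ) + 1 = n := by omega
    rw [h4, Nat.mod_self] at h2; omega

theorem dM_shift (n k : ℕ) [NeZero n] (hn : 2 ≤ n) (i : Fin k) (u : Node n k) :
    dM n k u (shift n k i u) = 1 := by
  unfold dM
  rw [Finset.sum_eq_single i]
  · simp only [shift, Function.update_self]
    rw [Fin.val_add, Fin.val_one', Nat.mod_eq_of_lt (show 1 < n by omega)]
    have := (u i).isLt
    rcases Nat.lt_or_ge ((u i : ℕ) + 1) n with h3 | h3
    · rw [Nat.mod_eq_of_lt h3]; omega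
    · have h4 : (u i : ℕ) + 1 = n := by omega
      rw [h4, Nat.mod_self]; omega
  · intro j _ hj
    simp [shift, Function.update_of_ne hj]
  · simp

theorem shift_closed (n k : ℕ) [NeZero n] (P : Node n k → Prop)
    (hP : ∀ i u, P u → P (shift n k i u)) (u v : Node n k) (hu : P u) : P v := by
  have h1 : ∀ (i : Fin k) (m : ℕ) (u : Node n k), P u →
      P (Function.update u i (Fin.ofNat n ((u i : ℕ) + m))) := by
    intro i m
    induction m with
    | zero => intro u hu; simpa using hu
    | succ m ih =>
      intro u hu
      have h := hP i _ (ih u hu)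
      have e : Fin.ofNat n ((u i : ℕ) + m) + 1 = Fin.ofNat n ((u i : ℕ) + (m + 1)) := by
        apply Fin.ext
        simp [Fin.val_add, Fin.ofNat, add_assoc]
      rw [shift, Function.update_self, Function.update_idem, e] at h
      exact h
  have h2 : ∀ (i : Fin k) (x : Fin n) (u : Node n k), P u → P (Function.update u i x) := by
    intro i x u hu
    have h := h1 i (n - (u i : ℕ) + x) u hu
    have e : Fin.ofNat n ((u i : ℕ) + (n - (u i : ℕ) + x)) = x := by
      apply Fin.ext
      have h3 := (u i).isLt
      have h4 : (u i : ℕ) + (n - (u i : ℕ) + x) = n + x := by omega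
      rw [h4]
      simp [Fin.ofNat, Nat.mod_eq_of_lt x.isLt]
    rw [e] at h
    exact h
  have h3 : ∀ S : Finset (Fin k), P (fun i => if i ∈ S then v i else u i) := by
    intro S
    induction S using Finset.induction_on with
    | empty => simpa using hu
    | insert a S ha ih =>
      have := h2 a (v a) _ ih
      convert this using 1
      funext j
      by_cases hj : j = a
      · subst hj; simp
      · simp [hj, Function.update_of_ne hj]
  simpa using h3 Finset.univ

theorem card_others (n k : ℕ) (u : Node n k) : (others n k u).card + 1 = n ^ k := by
  have h : others n k u = Finset.univ.erase u := by
    ext v; simp [others]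
  rw [h, Finset.card_erase_add_one (Finset.mem_univ u)]
  simp

theorem mem_others (n k : ℕ) (u v : Node n k) : v ∈ others n k u ↔ v ≠ u := by
  simp [others]

theorem sum_fin_abs (n : ℕ) (u : Fin n) (f : ℕ → ℝ) (hf : ∀ j, 0 ≤ f j) :
    ∑ x : Fin n, f ((u : ℤ) - (x : ℤ)).natAbs ≤ 2 * ∑ j ∈ Finset.range (n + 1), f j := by
  have gen : ∀ T : Finset (Fin n), Set.InjOn (fun x : Fin n => ((u : ℤ) - (x : ℤ)).natAbs) T →
      ∑ x ∈ T, f ((u : ℤ) - (x : ℤ)).natAbs ≤ ∑ j ∈ Finset.range (n + 1), f j := by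
    intro T hT
    rw [← Finset.sum_image (f := f) hT]
    apply Finset.sum_le_sum_of_subset_of_nonneg
    · intro j hj
      obtain ⟨x, _, rfl⟩ := Finset.mem_image.mp hj
      have := u.isLt
      have := x.isLt
      simp only [Finset.mem_range]
      omega
    · intro j _ _; exact hf j
  rw [← Finset.sum_filter_add_sum_filter_not Finset.univ (fun x : Fin n => x ≤ u), two_mul]
  apply add_le_add
  · apply gen
    intro x hx y hy hxy
    simp only [Finset.coe_filter, Finset.mem_univ, true_and, Set.mem_setOf_eq, Fin.le_def] at hx hy
    simp only at hxy
    apply Fin.ext; omega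
  · apply gen
    intro x hx y hy hxy
    simp only [Finset.coe_filter, Finset.mem_univ, true_and, Set.mem_setOf_eq, Fin.le_def] at hx hy
    simp only at hxy
    apply Fin.ext; omega

theorem harm_bound (n : ℕ) :
    ∑ j ∈ Finset.range (n + 1), (1 : ℝ) / (1 + j) ≤ 1 + Real.log (n + 1) := by
  have h := harmonic_le_one_add_log (n + 1)
  refine le_trans (le_of_eq ?_) (h.trans (le_of_eq ?_))
  · simp only [harmonic]
    push_cast
    refine Finset.sum_congr rfl fun j _ => ?_
    rw [one_div, add_comm]
  · push_cast; rfl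

theorem sum_coord (n : ℕ) (u : Fin n) :
    ∑ x : Fin n, (1 : ℝ) / (1 + ((min ((u : ℤ) - (x : ℤ)).natAbs
      (n - ((u : ℤ) - (x : ℤ)).natAbs) : ℕ) : ℝ)) ≤ 4 * (1 + Real.log (n + 1)) := by
  have h := sum_fin_abs n u (fun j => (1 : ℝ) / (1 + ((min j (n - j) : ℕ) : ℝ)))
    (fun j => by positivity)
  refine h.trans ?_
  have h2 : ∑ j ∈ Finset.range (n + 1), (1 : ℝ) / (1 + ((min j (n - j) : ℕ) : ℝ)) ≤
      ∑ j ∈ Finset.range (n + 1), ((1 : ℝ) / (1 + (j : ℝ)) + 1 / (1 + ((n - j : ℕ) : ℝ))) := by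
    refine Finset.sum_le_sum fun j _ => ?_
    rcases min_choice j (n - j) with h | h <;> rw [h]
    · have : (0:ℝ) ≤ 1 / (1 + ((n - j : ℕ) : ℝ)) := by positivity
      linarith
    · have : (0:ℝ) ≤ 1 / (1 + (j : ℝ)) := by positivity
      linarith
  rw [Finset.sum_add_distrib] at h2
  have h3 := Finset.sum_range_reflect (fun j : ℕ => (1 : ℝ) / (1 + (j : ℝ))) (n + 1)
  simp only [Nat.add_sub_cancel] at h3
  rw [h3] at h2
  have := harm_bound n
  linarith

theorem cnorm_k_le (n k : ℕ) (u : Node n k) :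
    cnorm n k u k ≤ (8 * (1 + Real.log (n + 1))) ^ k := by
  set a : Fin k → Fin n → ℕ := fun i x => min ((u i : ℤ) - (x : ℤ)).natAbs
      (n - ((u i : ℤ) - (x : ℤ)).natAbs) with ha
  have hterm : ∀ v ∈ others n k u, (dM n k u v : ℝ) ^ (-(k:ℝ)) ≤
      2 ^ k * ∏ i, (1 : ℝ) / (1 + (a i (v i) : ℝ)) := by
    intro v hv
    have hd := one_le_dM n k u v ((mem_others n k u v).mp hv)
    have hdR : (1:ℝ) ≤ dM n k u v := by exact_mod_cast hd
    rw [Real.rpow_neg (by positivity), Real.rpow_natCast, Finset.prod_div_distrib, Finset.prod_const_one,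
      mul_one_div, inv_eq_one_div, div_le_div_iff₀ (by positivity)
        (Finset.prod_pos fun i _ => by positivity), one_mul, ← mul_pow]
    calc ∏ i, (1 + (a i (v i) : ℝ)) ≤ ∏ _i : Fin k, (2 * (dM n k u v : ℝ)) := by
          refine Finset.prod_le_prod (fun i _ => by positivity) fun i _ => ?_
          have h1 : a i (v i) ≤ dM n k u v :=
            Finset.single_le_sum (f := fun i => a i (v i)) (fun _ _ => Nat.zero_le _)
              (Finset.mem_univ i)
          have h2 : (a i (v i) : ℝ) ≤ dM n k u v := by exact_mod_cast h1
          linarith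
      _ = _ := by simp
  unfold cnorm
  refine (Finset.sum_le_sum hterm).trans ?_
  rw [← Finset.mul_sum]
  have h1 : ∑ v ∈ others n k u, ∏ i, (1 : ℝ) / (1 + (a i (v i) : ℝ)) ≤
      ∑ v : Node n k, ∏ i, (1 : ℝ) / (1 + (a i (v i) : ℝ)) :=
    Finset.sum_le_sum_of_subset_of_nonneg (Finset.subset_univ _)
      (fun v _ _ => Finset.prod_nonneg fun i _ => by positivity)
  have h2 : ∑ v : Node n k, ∏ i, (1 : ℝ) / (1 + (a i (v i) : ℝ)) =
      ∏ i, ∑ x : Fin n, (1 : ℝ) / (1 + (a i x : ℝ)) :=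
    (Fintype.prod_sum (fun i x => (1 : ℝ) / (1 + (a i x : ℝ)))).symm
  have h3 : ∏ i, ∑ x : Fin n, (1 : ℝ) / (1 + (a i x : ℝ)) ≤
      ∏ _i : Fin k, (4 * (1 + Real.log (n + 1))) :=
    Finset.prod_le_prod (fun i _ => Finset.sum_nonneg fun x _ => by positivity)
      fun i _ => sum_coord n (u i)
  calc _ ≤ (2:ℝ) ^ k * ∏ _i : Fin k, (4 * (1 + Real.log (n + 1))) := by
        apply mul_le_mul_of_nonneg_left _ (by positivity)
        rw [← h2] at h3
        exact h1.trans h3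
    _ = _ := by
        simp only [Finset.prod_const, Finset.card_univ, Fintype.card_fin]
        rw [← mul_pow]; ring_nf

theorem growth (k g : ℕ) (hg : 2 ≤ g) (B : ℝ) (hB : 1 ≤ B) :
    ∃ n0 : ℕ, 2 ≤ n0 ∧ ∀ n : ℕ, n0 ≤ n →
      2 * B ^ 3 * ((8 * (1 + Real.log (n + 1))) ^ k) ^ 4 *
        (2 * B ^ 2 * ((8 * (1 + Real.log (n + 1))) ^ k) ^ 2) ^ (g * k) ≤ (n:ℝ) ^ ((g:ℝ)⁻¹) := by
  set γ : ℝ := (g:ℝ)⁻¹ with hγ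
  have hγ0 : 0 < γ := by positivity
  set p : ℕ := k * 4 + k * 2 * (g * k) with hp
  set C : ℝ := 2 * B ^ 3 * (2 * B ^ 2) ^ (g * k) * 8 ^ p with hC
  have hC0 : 0 < C := by positivity
  have hlo := isLittleO_log_rpow_rpow_atTop (p : ℝ) hγ0
  have hb := hlo.bound (c := (C * 6 ^ γ)⁻¹) (by positivity)
  have htend : Filter.Tendsto (fun n : ℕ => Real.exp 1 * ((n:ℝ) + 1)) Filter.atTop Filter.atTop :=
    Filter.Tendsto.const_mul_atTop (Real.exp_pos 1)
      (Filter.tendsto_atTop_add_const_right _ _ tendsto_natCast_atTop_atTop)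
  obtain ⟨n1, hn1⟩ := Filter.eventually_atTop.mp (htend.eventually hb)
  refine ⟨max n1 2, le_max_right _ _, fun n hn => ?_⟩
  have h := hn1 n ((le_max_left _ _).trans hn)
  have hn2 : (2:ℝ) ≤ n := by exact_mod_cast (le_max_right _ _).trans hn
  rw [Real.log_mul (Real.exp_pos 1).ne' (by positivity), Real.log_exp, Real.rpow_natCast] at h
  have hl : 0 ≤ 1 + Real.log ((n:ℝ) + 1) := by
    have := Real.log_nonneg (show (1:ℝ) ≤ n + 1 by linarith)
    linarith
  set l := 1 + Real.log ((n:ℝ) + 1) with hldef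
  rw [Real.norm_of_nonneg (by positivity), Real.norm_of_nonneg (by positivity)] at h
  have he : (Real.exp 1 * ((n:ℝ) + 1)) ^ γ ≤ 6 ^ γ * (n:ℝ) ^ γ := by
    rw [← Real.mul_rpow (by norm_num) (by positivity)]
    apply Real.rpow_le_rpow (by positivity) _ hγ0.le
    have := Real.exp_one_lt_d9
    nlinarith
  have e1 : 2 * B ^ 3 * ((8 * l) ^ k) ^ 4 * (2 * B ^ 2 * ((8 * l) ^ k) ^ 2) ^ (g * k) =
      C * l ^ p := by
    rw [hC, mul_pow (2 * B ^ 2), ← pow_mul, ← pow_mul, ← pow_mul]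
    have : (8:ℝ) ^ p * l ^ p = (8 * l) ^ (k * 4) * (8 * l) ^ (k * 2 * (g * k)) := by
      rw [← mul_pow, hp, pow_add]
    calc _ = 2 * B ^ 3 * (2 * B ^ 2) ^ (g * k) *
          ((8 * l) ^ (k * 4) * (8 * l) ^ (k * 2 * (g * k))) := by ring
      _ = _ := by rw [← this]; ring
  rw [e1]
  calc C * l ^ p ≤ C * ((C * 6 ^ γ)⁻¹ * (6 ^ γ * (n:ℝ) ^ γ)) := by
        apply mul_le_mul_of_nonneg_left _ hC0.le
        exact h.trans (mul_le_mul_of_nonneg_left he (by positivity))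
    _ = _ := by field_simp

theorem best_k (k g : ℕ) (hk : 1 ≤ k) (hg : 2 ≤ g) :
    ∃ n0 : ℕ, 2 ≤ n0 ∧ ∀ n : ℕ, n0 ≤ n →
      ∀ r : Node n k → ℝ, ValidProfile n k (g : ℝ)⁻¹ r →
      ∀ u w : Node n k, w ≠ u → dM n k u w = 1 → 0 < r w →
        BRStep n k (g : ℝ)⁻¹ r (Function.update r u (k : ℝ)) := by
  have hkR : (1:ℝ) ≤ k := by exact_mod_cast hk
  have hgR : (2:ℝ) ≤ g := by exact_mod_cast hg
  have hγ0 : 0 < (g:ℝ)⁻¹ := by positivity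
  set B : ℝ := 2 * (k:ℝ) ^ k with hBdef
  have hB1 : 1 ≤ B := by
    have : 1 ≤ (k:ℝ) ^ k := one_le_pow₀ hkR
    linarith
  obtain ⟨n0, hn02, hn0⟩ := growth k g hg B hB1
  refine ⟨n0, hn02, fun n hn r hr u w hwu hdw hrw => ?_⟩
  have hn2 : 2 ≤ n := hn02.trans hn
  have hnR : (2:ℝ) ≤ n := by exact_mod_cast hn2
  have hgrow := hn0 n hn
  set Λ : ℝ := (8 * (1 + Real.log ((n:ℝ) + 1))) ^ k with hΛdef
  have hΛ : ∀ v, cnorm n k v k ≤ Λ := cnorm_k_le n k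
  have hΛ1 : 1 ≤ Λ := by
    apply one_le_pow₀
    have := Real.log_nonneg (show (1:ℝ) ≤ n + 1 by linarith)
    linarith
  set M : ℝ := (k:ℝ) * n with hM
  have hM0 : 0 < M := by positivity
  have hd1 : ∀ v v' : Node n k, v' ≠ v → (1:ℝ) ≤ dM n k v v' := fun v v' h => by
    exact_mod_cast one_le_dM n k v v' h
  have hdM : ∀ v v' : Node n k, (dM n k v v' : ℝ) ≤ M := fun v v' => by
    rw [hM]; exact_mod_cast dM_le n k v v'
  have hcard : ∀ v, M ^ (k:ℝ) ≤ B * ((others n k v).card : ℝ) := by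
    intro v
    have h1 : ((others n k v).card : ℝ) + 1 = (n:ℝ) ^ k := by exact_mod_cast card_others n k v
    have h2 : (2:ℝ) ≤ (n:ℝ) ^ k := hnR.trans (le_self_pow₀ (by linarith) (by omega))
    rw [Real.rpow_natCast, hM, mul_pow, hBdef]
    have h3 : (n:ℝ) ^ k ≤ 2 * ((others n k v).card : ℝ) := by linarith
    have h4 := mul_le_mul_of_nonneg_left h3 (show (0:ℝ) ≤ (k:ℝ) ^ k by positivity)
    linarith
  have hr0 : ∀ v, 0 ≤ r v := fun v => by
    obtain ⟨m, hm⟩ := hr v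
    rw [hm]; positivity
  haveI : NeZero n := ⟨by omega⟩
  let i0 : Fin k := ⟨0, by omega⟩
  have hc1 : ∀ v (s : ℝ), 1 ≤ cnorm n k v s := by
    intro v s
    have := Finset.single_le_sum (s := others n k v) (f := fun x => (dM n k v x : ℝ) ^ (-s))
      (fun x _ => by positivity) ((mem_others n k v _).mpr (shift_ne n k hn2 i0 v))
    simp only [dM_shift n k hn2 i0 v, Nat.cast_one, Real.one_rpow] at this
    exact this
  have hq0 : ∀ v, 0 ≤ linkProb n k v u (r v) := fun v => by
    have := hc1 v (r v)
    unfold linkProb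
    positivity
  have hq : ∀ v, v ≠ u → linkProb n k v u (r v) ≤ B * (dM n k u v : ℝ) ^ (-(k:ℝ)) := by
    intro v hv
    unfold linkProb
    rw [dM_comm n k v u]
    have hd := hd1 u v hv
    have hd' := hdM u v
    have hc := hc1 v (r v)
    set d : ℝ := (dM n k u v : ℝ) with hddef
    have hdpos : 0 < d := by linarith
    rcases le_total (k:ℝ) (r v) with h | h
    · calc d ^ (-r v) / cnorm n k v (r v) ≤ d ^ (-r v) := div_le_self (by positivity) hc
        _ ≤ d ^ (-(k:ℝ)) := Real.rpow_le_rpow_of_exponent_le hd (by linarith)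
        _ ≤ _ := le_mul_of_one_le_left (by positivity) hB1
    · rw [div_le_iff₀ (by linarith)]
      have h1 : ((others n k v).card : ℝ) * M ^ (-r v) ≤ cnorm n k v (r v) := by
        rw [← nsmul_eq_mul]
        apply Finset.card_nsmul_le_sum
        intro x hx
        have := hd1 v x ((mem_others n k v x).mp hx)
        exact Real.rpow_le_rpow_of_nonpos (by linarith) (hdM v x) (by linarith [hr0 v])
      have h2 : M ^ (k - r v) ≤ B * cnorm n k v (r v) := by
        rw [sub_eq_add_neg, Real.rpow_add hM0]
        calc _ ≤ B * ((others n k v).card : ℝ) * M ^ (-r v) :=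
              mul_le_mul_of_nonneg_right (hcard v) (by positivity)
          _ = B * (((others n k v).card : ℝ) * M ^ (-r v)) := by ring
          _ ≤ _ := mul_le_mul_of_nonneg_left h1 (by linarith)
      calc d ^ (-r v) = d ^ (-(k:ℝ)) * d ^ (k - r v) := by
            rw [← Real.rpow_add hdpos]; ring_nf
        _ ≤ d ^ (-(k:ℝ)) * M ^ (k - r v) := by
            apply mul_le_mul_of_nonneg_left _ (by positivity)
            exact Real.rpow_le_rpow hdpos.le hd' (by linarith)
        _ ≤ d ^ (-(k:ℝ)) * (B * cnorm n k v (r v)) := mul_le_mul_of_nonneg_left h2 (by positivity)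
        _ = _ := by ring
  have hγ1 : (g:ℝ)⁻¹ ≤ 1 := inv_le_one_of_one_le₀ (by linarith)
  have hqw : M ^ (-((k:ℝ) - (g:ℝ)⁻¹)) ≤ Λ * linkProb n k w u (r w) := by
    unfold linkProb
    rw [dM_comm n k w u, hdw, Nat.cast_one, Real.one_rpow, mul_one_div,
      le_div_iff₀ (by linarith [hc1 w (r w)])]
    have hrγ : (g:ℝ)⁻¹ ≤ r w := by
      obtain ⟨m, hm⟩ := hr w
      rw [hm] at hrw ⊢
      have : m ≠ 0 := by rintro rfl; simp at hrw
      have : (1:ℝ) ≤ m := by exact_mod_cast Nat.one_le_iff_ne_zero.mpr this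
      exact le_mul_of_one_le_left hγ0.le this
    have h1 : cnorm n k w (r w) ≤ Λ * M ^ ((k:ℝ) - (g:ℝ)⁻¹) := by
      refine le_trans ?_ (mul_le_mul_of_nonneg_right (hΛ w) (by positivity))
      unfold cnorm
      rw [Finset.sum_mul]
      refine Finset.sum_le_sum fun x hx => ?_
      have hd := hd1 w x ((mem_others n k w x).mp hx)
      have hdpos : (0:ℝ) < dM n k w x := by linarith
      calc (dM n k w x : ℝ) ^ (-r w) ≤ (dM n k w x : ℝ) ^ (-(g:ℝ)⁻¹) :=
            Real.rpow_le_rpow_of_exponent_le hd (by linarith)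
        _ = (dM n k w x : ℝ) ^ (-(k:ℝ)) * (dM n k w x : ℝ) ^ ((k:ℝ) - (g:ℝ)⁻¹) := by
            rw [← Real.rpow_add hdpos]; ring_nf
        _ ≤ _ := by
            apply mul_le_mul_of_nonneg_left _ (by positivity)
            exact Real.rpow_le_rpow hdpos.le (hdM w x) (by linarith)
    calc _ ≤ M ^ (-((k:ℝ) - (g:ℝ)⁻¹)) * (Λ * M ^ ((k:ℝ) - (g:ℝ)⁻¹)) :=
          mul_le_mul_of_nonneg_left h1 (by positivity)
      _ = Λ * (M ^ (-((k:ℝ) - (g:ℝ)⁻¹)) * M ^ ((k:ℝ) - (g:ℝ)⁻¹)) := by ring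
      _ = Λ := by rw [← Real.rpow_add hM0]; simp
  have hpay : ∀ s : ℝ, payoff n k (Function.update r u s) u =
      (∑ v ∈ others n k u, (dM n k u v : ℝ) ^ (-s) /
        (∑ v ∈ others n k u, (dM n k u v : ℝ) ^ (-s)) * (dM n k u v : ℝ)) *
      (∑ v ∈ others n k u, (dM n k u v : ℝ) ^ (-s) /
        (∑ v ∈ others n k u, (dM n k u v : ℝ) ^ (-s)) * linkProb n k v u (r v)) := by
    intro s
    unfold payoff linkDist recip
    rw [Function.update_self]
    congr 1
    refine Finset.sum_congr rfl fun v hv => ?_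
    rw [Function.update_of_ne ((mem_others n k u v).mp hv)]
    rfl
  refine ⟨u, k, ⟨k * g, ?_⟩, ?_, rfl⟩
  · push_cast; field_simp
  rintro t ⟨m, rfl⟩
  rw [ge_iff_le, hpay, hpay]
  refine core_aux (others n k u) (fun v => (dM n k u v : ℝ)) (fun v => linkProb n k v u (r v))
    k g hk hg M Λ B w ((mem_others n k u w).mpr hwu) (by simp [hdw])
    (fun v hv => hd1 u v ((mem_others n k u v).mp hv)) (fun v _ => hdM u v) hΛ1 hB1 (hΛ u)
    (hcard u) (fun v _ => hq0 v) (fun v hv => hq v ((mem_others n k u v).mp hv)) hqw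
    (hgrow.trans ?_) _ (by positivity) ?_
  · apply Real.rpow_le_rpow (by positivity) _ hγ0.le
    rw [hM]; exact le_mul_of_one_le_left (by positivity) hkR
  · have hkg : (k:ℝ) = ((k * g : ℕ) : ℝ) * (g:ℝ)⁻¹ := by push_cast; field_simp
    rcases lt_trichotomy m (k * g) with h | h | h
    · right; left
      have : (m:ℝ) + 1 ≤ ((k * g : ℕ) : ℝ) := by exact_mod_cast h
      have := mul_le_mul_of_nonneg_right this hγ0.le
      linarith
    · left; rw [h, ← hkg]
    · right; right
      have : ((k * g : ℕ) : ℝ) + 1 ≤ (m:ℝ) := by exact_mod_cast h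
      have := mul_le_mul_of_nonneg_right this hγ0.le
      linarith

end DRB

/-- For sufficiently large `n`, from every strategy profile `r ≢ 0`
there is a finite sequence of asynchronous best-response steps ending at the
navigable profile `r ≡ k`. -/
theorem navigable_reachable_async (k g : ℕ) (hk : 1 ≤ k) (hg : 2 ≤ g) :
    ∃ n0 : ℕ, ∀ n : ℕ, n0 ≤ n →
      ∀ r : DRB.Node n k → ℝ, DRB.ValidProfile n k (g : ℝ)⁻¹ r →
        (∃ u : DRB.Node n k, 0 < r u) →
        Relation.ReflTransGen (DRB.BRStep n k (g : ℝ)⁻¹) r (fun _ => (k : ℝ)) := by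
  classical
  obtain ⟨n0, hn02, hn0⟩ := DRB.best_k k g hk hg
  refine ⟨n0, fun n hn => ?_⟩
  have hn2 : 2 ≤ n := hn02.trans hn
  have hkR : (1:ℝ) ≤ k := by exact_mod_cast hk
  haveI : NeZero n := ⟨by omega⟩
  have main : ∀ N : ℕ, ∀ r : DRB.Node n k → ℝ, DRB.ValidProfile n k (g : ℝ)⁻¹ r →
      (∃ u : DRB.Node n k, 0 < r u) →
      (Finset.univ.filter (fun v => r v ≠ (k:ℝ))).card = N →
      Relation.ReflTransGen (DRB.BRStep n k (g : ℝ)⁻¹) r (fun _ => (k : ℝ)) := by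
    intro N
    induction N with
    | zero =>
      intro r _ _ hcard
      have : r = fun _ => (k:ℝ) := by
        funext v
        by_contra hv
        have := Finset.card_eq_zero.mp hcard
        have hv' : v ∈ Finset.univ.filter (fun v => r v ≠ (k:ℝ)) := by simp [hv]
        rw [this] at hv'
        simp at hv'
      rw [this]
    | succ N ih =>
      intro r hr hpos hcard
      have hpair : ∃ u w : DRB.Node n k, r u ≠ k ∧ w ≠ u ∧ DRB.dM n k u w = 1 ∧ 0 < r w := by
        by_cases hall : ∀ v, 0 < r v
        · have hne : (Finset.univ.filter (fun v => r v ≠ (k:ℝ))).Nonempty := by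
            rw [← Finset.card_pos]; omega
          obtain ⟨u, hu⟩ := hne
          refine ⟨u, DRB.shift n k ⟨0, by omega⟩ u, (Finset.mem_filter.mp hu).2,
            DRB.shift_ne n k hn2 _ u, DRB.dM_shift n k hn2 _ u, hall _⟩
        · by_contra hcon
          apply hall
          obtain ⟨u0, hu0⟩ := hpos
          intro v
          refine DRB.shift_closed n k (fun v => 0 < r v) ?_ u0 v hu0
          intro i w hw
          by_contra hneg
          apply hcon
          refine ⟨DRB.shift n k i w, w, fun h => hneg (by rw [h]; linarith),
            (DRB.shift_ne n k hn2 i w).symm, ?_, hw⟩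
          rw [DRB.dM_comm]
          exact DRB.dM_shift n k hn2 i w
      obtain ⟨u, w, huk, hwu, hd, hw⟩ := hpair
      have hstep := hn0 n hn r hr u w hwu hd hw
      refine Relation.ReflTransGen.head hstep (ih _ ?_ ⟨u, ?_⟩ ?_)
      · intro v
        by_cases hv : v = u
        · subst hv
          rw [Function.update_self]
          refine ⟨k * g, ?_⟩
          push_cast
          field_simp
        · rw [Function.update_of_ne hv]; exact hr v
      · rw [Function.update_self]; linarith
      · have : Finset.univ.filter (fun v => Function.update r u (k:ℝ) v ≠ (k:ℝ)) =
            (Finset.univ.filter (fun v => r v ≠ (k:ℝ))).erase u := by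
          ext v
          by_cases hv : v = u
          · subst hv; simp
          · simp [hv, Function.update_of_ne hv]
        rw [this, Finset.card_erase_of_mem (by simp [huk]), hcard]
        rfl
  intro r hr hpos
  exact main _ r hr hpos rfl
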